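/- For i ∈ ℤ let η_i : ℚ_p → ℂ be η_i(t) = (1 − 1/p)^{−1/2}·p^{−i/2}·1_{|t|_p = p^i}(t) (these form an orthonormal family in L²(ℚ_p, μ)). Then the matrix elements of the conductor operator in this family are ⟨H(η_i), η_j⟩ = ∫_{ℚ_p} H(η_i)(t)·conj(η_j(t)) dμ(t) = −log(p)·p^{−|i−j|/2} for i ≠ j, and ⟨H(η_i), η_i⟩ = 0. -/

import Mathlib

open MeasureTheory Complex

variable {p : ℕ} [Fact p.Prime]

/-- The `p`-adic Fourier transform `𝓕f(ξ) = ∫ f(t)·e(tξ) dμ(t)`. -/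
noncomputable def padicFourier [MeasurableSpace ℚ_[p]] (μ : Measure ℚ_[p])
    (e : AddChar ℚ_[p] Circle) (f : ℚ_[p] → ℂ) (ξ : ℚ_[p]) : ℂ :=
  ∫ t, f t * (e (t * ξ) : ℂ) ∂μ

/-- The inverse `p`-adic Fourier transform `𝓕⁻¹f(t) = ∫ f(ξ)·e(−tξ) dμ(ξ)`. -/
noncomputable def padicFourierInv [MeasurableSpace ℚ_[p]] (μ : Measure ℚ_[p])
    (e : AddChar ℚ_[p] Circle) (f : ℚ_[p] → ℂ) (t : ℚ_[p]) : ℂ :=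
  ∫ ξ, f ξ * (e (-(t * ξ)) : ℂ) ∂μ

/-- The conductor operator on `ℚ_p`:
`H(φ)(t) = log|t|_p·φ(t) + ∫ log|ξ|_p·(𝓕⁻¹φ)(ξ)·e(tξ) dμ(ξ)`. -/
noncomputable def padicCondOp [MeasurableSpace ℚ_[p]] (μ : Measure ℚ_[p])
    (e : AddChar ℚ_[p] Circle) (φ : ℚ_[p] → ℂ) (t : ℚ_[p]) : ℂ :=
  (Real.log ‖t‖ : ℂ) * φ t +
    ∫ ξ, (Real.log ‖ξ‖ : ℂ) * padicFourierInv μ e φ ξ * (e (t * ξ) : ℂ) ∂μ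

/-- The orthonormal family `η_i(t) = (1 − 1/p)^{−1/2}·p^{−i/2}·1_{|t|_p = p^i}(t)`. -/
noncomputable def eta (i : ℤ) (t : ℚ_[p]) : ℂ :=
  (((1 - 1 / (p : ℝ)) ^ (-(1 / 2 : ℝ)) * (p : ℝ) ^ (-((i : ℝ)) / 2) : ℝ) : ℂ) *
    (if ‖t‖ = (p : ℝ) ^ i then 1 else 0)

/-- The ball of radius `p ^ n`. -/
def pball (p : ℕ) [Fact p.Prime] (n : ℤ) : Set ℚ_[p] := {x | ‖x‖ ≤ (p : ℝ) ^ n}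

/-- The sphere of radius `p ^ n`. -/
def psph (p : ℕ) [Fact p.Prime] (n : ℤ) : Set ℚ_[p] := {x | ‖x‖ = (p : ℝ) ^ n}

lemma one_lt_p (p : ℕ) [hp : Fact p.Prime] : (1 : ℝ) < p := by
  exact_mod_cast hp.out.one_lt

lemma pball_mono {m n : ℤ} (h : m ≤ n) : pball p m ⊆ pball p n := fun x hx =>
  le_trans hx (zpow_le_zpow_right₀ (one_lt_p p).le h)

lemma psph_eq (n : ℤ) : psph p n = pball p n \ pball p (n - 1) := by
  ext x
  simp only [psph, pball, Set.mem_ofPred_eq, Set.mem_sdiff,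
    Padic.norm_le_pow_iff_norm_lt_pow_add_one x (n - 1), sub_add_cancel, not_lt]
  exact le_antisymm_iff

lemma pball_add {n : ℤ} {x y : ℚ_[p]} (hx : x ∈ pball p n) (hy : y ∈ pball p n) :
    x + y ∈ pball p n :=
  (Padic.nonarchimedean x y).trans (max_le hx hy)

lemma pball_neg {n : ℤ} {x : ℚ_[p]} : -x ∈ pball p n ↔ x ∈ pball p n := by
  simp [pball]

lemma pball_isClosed (n : ℤ) : IsClosed (pball p n) :=
  isClosed_le continuous_norm continuous_const

section
variable [MeasurableSpace ℚ_[p]] [BorelSpace ℚ_[p]]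

lemma pball_meas (n : ℤ) : MeasurableSet (pball p n) := (pball_isClosed n).measurableSet

lemma psph_meas (n : ℤ) : MeasurableSet (psph p n) := by
  rw [psph_eq]; exact (pball_meas n).diff (pball_meas _)

lemma pball_fin (μ : Measure ℚ_[p]) [μ.IsAddHaarMeasure] (n : ℤ) : μ (pball p n) ≠ ⊤ := by
  have : pball p n = Metric.closedBall 0 ((p : ℝ) ^ n) := by
    ext x; simp [pball]
  rw [this]
  exact (isCompact_closedBall _ _).measure_lt_top.ne

lemma pball_cosets (n : ℤ) : pball p (n + 1) =
    ⋃ a ∈ Finset.range p, (fun x => (a : ℚ_[p]) * (p : ℚ_[p]) ^ (-(n + 1)) + x) '' pball p n := by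
  have hp0 : (p : ℚ_[p]) ≠ 0 := by exact_mod_cast (Fact.out : p.Prime).ne_zero
  have hp1 := one_lt_p p
  ext x
  simp only [Set.mem_iUnion, Finset.mem_range, Set.mem_image]
  constructor
  · intro hx
    have hy : ‖x * (p : ℚ_[p]) ^ (n + 1)‖ ≤ 1 := by
      rw [norm_mul, Padic.norm_p_zpow]
      have : ‖x‖ ≤ (p : ℝ) ^ (n + 1) := hx
      calc _ ≤ (p : ℝ) ^ (n + 1) * (p : ℝ) ^ (-(n + 1)) := by gcongr
        _ = 1 := by rw [← zpow_add₀ (by positivity)]; simp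
    obtain ⟨Y, hY⟩ : ∃ Y : ℤ_[p], (Y : ℚ_[p]) = x * (p : ℚ_[p]) ^ (n + 1) := ⟨⟨_, hy⟩, rfl⟩
    obtain ⟨a, ha, hm⟩ := PadicInt.exists_mem_range Y
    rw [PadicInt.maximalIdeal_eq_span_p, Ideal.mem_span_singleton,
      ← PadicInt.norm_lt_one_iff_dvd] at hm
    refine ⟨a, ha, x - a * (p : ℚ_[p]) ^ (-(n + 1)), ?_, by ring⟩
    have hm' : ‖x * (p : ℚ_[p]) ^ (n + 1) - a‖ < 1 := by
      rw [PadicInt.norm_def, PadicInt.coe_sub, PadicInt.coe_natCast, hY] at hm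
      exact hm
    have e1 : x - a * (p : ℚ_[p]) ^ (-(n + 1)) =
        (x * (p : ℚ_[p]) ^ (n + 1) - a) * (p : ℚ_[p]) ^ (-(n + 1)) := by
      rw [sub_mul, mul_assoc, ← zpow_add₀ hp0]; simp
    show ‖_‖ ≤ _
    rw [Padic.norm_le_pow_iff_norm_lt_pow_add_one, e1, norm_mul, Padic.norm_p_zpow, neg_neg]
    have : (0 : ℝ) < (p : ℝ) ^ (n + 1) := by positivity
    nlinarith
  · rintro ⟨a, ha, y, hy, rfl⟩
    refine pball_add ?_ (pball_mono (by omega) hy)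
    show ‖_‖ ≤ _
    rw [norm_mul, Padic.norm_p_zpow, neg_neg]
    have : ‖(a : ℚ_[p])‖ ≤ 1 := by exact_mod_cast Padic.norm_int_le_one (p := p) a
    have : (0 : ℝ) < (p : ℝ) ^ (n + 1) := by positivity
    nlinarith

lemma pball_succ (μ : Measure ℚ_[p]) [μ.IsAddHaarMeasure] (n : ℤ) :
    μ (pball p (n + 1)) = p * μ (pball p n) := by
  have hp0 : (p : ℚ_[p]) ≠ 0 := by exact_mod_cast (Fact.out : p.Prime).ne_zero
  have hp1 := one_lt_p p
  rw [pball_cosets, measure_biUnion_finset]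
  · have : ∀ a ∈ Finset.range p, μ ((fun x => (a : ℚ_[p]) * (p : ℚ_[p]) ^ (-(n + 1)) + x) ''
        pball p n) = μ (pball p n) := by
      intro a _
      simp
    rw [Finset.sum_congr rfl this]
    simp
  · intro a ha b hb hab
    rw [Function.onFun, Set.disjoint_left]
    rintro _ ⟨x, hx, rfl⟩ ⟨y, hy, h⟩
    apply hab
    have h1 : ((a : ℚ_[p]) - b) * (p : ℚ_[p]) ^ (-(n + 1)) ∈ pball p n := by
      have : ((a : ℚ_[p]) - b) * (p : ℚ_[p]) ^ (-(n + 1)) = y + -x := by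
        simp only at h
        linear_combination -h
      rw [this]
      exact pball_add hy (pball_neg.2 hx)
    have h2 : ‖((a : ℚ_[p]) - b) * (p : ℚ_[p]) ^ (-(n + 1))‖ < (p : ℝ) ^ (n + 1) :=
      (Padic.norm_le_pow_iff_norm_lt_pow_add_one _ _).1 h1
    rw [norm_mul, Padic.norm_p_zpow, neg_neg] at h2
    have h3 : (0 : ℝ) < (p : ℝ) ^ (n + 1) := by positivity
    have h4 : ‖(((a : ℤ) - (b : ℤ) : ℤ) : ℚ_[p])‖ < 1 := by
      push_cast
      nlinarith
    rw [Padic.norm_intCast_lt_one_iff] at h4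
    have ha' := Finset.mem_range.1 ha
    have hb' := Finset.mem_range.1 hb
    have := Int.eq_zero_of_abs_lt_dvd h4 (by rw [abs_lt]; omega)
    omega
  · intro a _
    have : (fun x => (a : ℚ_[p]) * (p : ℚ_[p]) ^ (-(n + 1)) + x) '' pball p n =
        (fun x => -((a : ℚ_[p]) * (p : ℚ_[p]) ^ (-(n + 1))) + x) ⁻¹' pball p n := by
      simp
    rw [this]
    exact (pball_meas n).preimage (measurable_const_add _)

lemma pball_real (μ : Measure ℚ_[p]) [μ.IsAddHaarMeasure]
    (hμ : μ {x : ℚ_[p] | ‖x‖ ≤ 1} = 1) (n : ℤ) : μ.real (pball p n) = (p : ℝ) ^ n := by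
  have hp1 := one_lt_p p
  have hs : ∀ n, μ.real (pball p (n + 1)) = p * μ.real (pball p n) := by
    intro n; simp [Measure.real, pball_succ μ n]
  induction n using Int.induction_on with
  | zero => simp [pball, Measure.real, hμ]
  | succ i ih => rw [hs, ih, zpow_add_one₀ (by positivity)]; ring
  | pred i ih =>
    have := hs (-(i : ℤ) - 1)
    rw [sub_add_cancel, ih] at this
    rw [zpow_sub_one₀ (by positivity), this]
    field_simp

lemma psph_real (μ : Measure ℚ_[p]) [μ.IsAddHaarMeasure]
    (hμ : μ {x : ℚ_[p] | ‖x‖ ≤ 1} = 1) (n : ℤ) :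
    μ.real (psph p n) = (p : ℝ) ^ n * (1 - 1 / p) := by
  have hp1 := one_lt_p p
  rw [psph_eq, measureReal_sdiff (pball_mono (by omega)) (pball_meas _) (pball_fin μ _),
    pball_real μ hμ, pball_real μ hμ, zpow_sub_one₀ (by positivity)]
  ring

lemma char_one {e : AddChar ℚ_[p] Circle} (he1 : ∀ x : ℤ_[p], e (x : ℚ_[p]) = 1)
    {x : ℚ_[p]} (hx : ‖x‖ ≤ 1) : e x = 1 := he1 ⟨x, hx⟩

/-- Fourier transform of the indicator function of a ball. -/
lemma fourier_ball (μ : Measure ℚ_[p]) [μ.IsAddHaarMeasure]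
    (hμ : μ {x : ℚ_[p] | ‖x‖ ≤ 1} = 1)
    (e : AddChar ℚ_[p] Circle)
    (he1 : ∀ x : ℤ_[p], e (x : ℚ_[p]) = 1)
    (he2 : ∃ x : ℚ_[p], ‖x‖ ≤ p ∧ e x ≠ 1) (n : ℤ) (ξ : ℚ_[p]) :
    ∫ t in pball p n, (e (t * ξ) : ℂ) ∂μ =
      (pball p (-n)).indicator (fun _ => (p : ℂ) ^ n) ξ := by
  have hp1 := one_lt_p p
  by_cases h : ξ ∈ pball p (-n)
  · rw [Set.indicator_of_mem h]
    have : ∀ t ∈ pball p n, (e (t * ξ) : ℂ) = 1 := by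
      intro t ht
      rw [char_one he1]; · simp
      rw [norm_mul]
      calc _ ≤ (p : ℝ) ^ n * (p : ℝ) ^ (-n) :=
            mul_le_mul ht h (norm_nonneg _) (by positivity)
        _ = 1 := by rw [← zpow_add₀ (by positivity)]; simp
    rw [setIntegral_congr_fun (pball_meas n) this, setIntegral_const, pball_real μ hμ]
    simp
  · rw [Set.indicator_of_notMem h]
    obtain ⟨x, hx, hex⟩ := he2
    have hξ : (p : ℝ) ^ (-n + 1) ≤ ‖ξ‖ := by
      have h' : ¬ ‖ξ‖ ≤ (p : ℝ) ^ (-n) := h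
      rw [Padic.norm_le_pow_iff_norm_lt_pow_add_one, not_lt] at h'
      exact h'
    have hpos : (0 : ℝ) < (p : ℝ) ^ (-n + 1) := by positivity
    have hξ0 : ξ ≠ 0 := by
      rintro rfl; simp at hξ; linarith
    have ha : x / ξ ∈ pball p n := by
      show ‖_‖ ≤ _
      rw [norm_div, div_le_iff₀ (by positivity)]
      calc ‖x‖ ≤ p := hx
        _ = (p : ℝ) ^ n * (p : ℝ) ^ (-n + 1) := by rw [← zpow_add₀ (by positivity)]; simp
        _ ≤ _ := by gcongr
    rw [← integral_indicator (pball_meas n)]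
    set F := (pball p n).indicator (fun t => (e (t * ξ) : ℂ)) with hF
    have h1 : ∫ t, F (x / ξ + t) ∂μ = ∫ t, F t ∂μ := integral_add_left_eq_self F (x / ξ)
    have h2 : ∀ t, F (x / ξ + t) = (e x : ℂ) * F t := by
      intro t
      by_cases ht : t ∈ pball p n
      · rw [hF, Set.indicator_of_mem ht, Set.indicator_of_mem (pball_add ha ht), add_mul,
          div_mul_cancel₀ _ hξ0, AddChar.map_add_eq_mul]
        simp
      · rw [hF, Set.indicator_of_notMem ht, Set.indicator_of_notMem, mul_zero]
        intro h
        apply ht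
        have := pball_add (pball_neg.2 ha) h
        simpa using this
    simp_rw [h2, integral_const_mul] at h1
    have h3 : (e x : ℂ) ≠ 1 := by
      intro h; apply hex; ext; simpa using h
    have h4 : ((e x : ℂ) - 1) * ∫ t, F t ∂μ = 0 := by linear_combination h1
    exact (mul_eq_zero.1 h4).resolve_left (sub_ne_zero.2 h3)

/-- The integral of `log` over spheres. -/
lemma log_on_sph {n : ℤ} {x : ℚ_[p]} (h : x ∈ psph p n) :
    Real.log ‖x‖ = n * Real.log p := by
  have h : ‖x‖ = (p : ℝ) ^ n := h
  rw [h, Real.log_zpow]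

lemma log_hasSum (μ : Measure ℚ_[p]) [μ.IsAddHaarMeasure]
    (hμ : μ {x : ℚ_[p] | ‖x‖ ≤ 1} = 1) (n : ℤ) :
    IntegrableOn (fun x => Real.log ‖x‖) (pball p n) μ ∧
    ∫ x in pball p n, Real.log ‖x‖ ∂μ = Real.log p * (p : ℝ) ^ n * (n - 1 / (p - 1)) := by
  have hp1 := one_lt_p p
  have hlog : 0 < Real.log p := Real.log_pos hp1
  have hU : pball p n = (⋃ k : ℕ, psph p (n - k)) ∪ {0} := by
    ext x
    simp only [Set.mem_union, Set.mem_iUnion, Set.mem_singleton_iff]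
    constructor
    · intro hx
      by_cases h0 : x = 0
      · exact Or.inr h0
      · left
        have h1 := Padic.norm_eq_zpow_neg_valuation h0
        have h2 : ‖x‖ ≤ (p : ℝ) ^ n := hx
        rw [h1, zpow_le_zpow_iff_right₀ hp1] at h2
        refine ⟨(n + x.valuation).toNat, ?_⟩
        show ‖x‖ = _
        rw [h1]; congr 1; omega
    · rintro (⟨k, hk⟩ | rfl)
      · rw [psph_eq] at hk
        exact pball_mono (by omega) hk.1
      · show ‖_‖ ≤ _
        rw [norm_zero]; positivity
  have hae : (pball p n : Set ℚ_[p]) =ᵐ[μ] (⋃ k : ℕ, psph p (n - k) : Set ℚ_[p]) := by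
    rw [hU]
    exact union_ae_eq_left_of_ae_eq_empty (by
      rw [ae_eq_empty]; exact measure_singleton 0)
  have hfin : ∀ m, μ (psph p m) ≠ ⊤ := fun m => by
    rw [psph_eq]; exact measure_ne_top_of_subset Set.sdiff_subset (pball_fin μ m)
  have hic : ∀ m, IntegrableOn (fun x => Real.log ‖x‖) (psph p m) μ := fun m => by
    have : IntegrableOn (fun _ => (m : ℝ) * Real.log p) (psph p m) μ :=
      integrableOn_const (hfin m)
    exact this.congr_fun (fun x hx => (log_on_sph hx).symm) (psph_meas m)
  have hr : ‖(1 / p : ℝ)‖ < 1 := by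
    rw [Real.norm_of_nonneg (by positivity)]; rw [div_lt_one (by positivity)]; exact hp1
  have hz : ∀ k : ℕ, (p : ℝ) ^ (n - k) = (p : ℝ) ^ n * (1 / p) ^ k := by
    intro k; rw [zpow_sub₀ (by positivity)]; simp [div_eq_mul_inv]
  have hs1 := hasSum_coe_mul_geometric_of_norm_lt_one hr
  have hs0 := hasSum_geometric_of_norm_lt_one hr
  have hI : IntegrableOn (fun x => Real.log ‖x‖) (⋃ k : ℕ, psph p (n - k)) μ := by
    refine integrableOn_iUnion_of_summable_integral_norm (fun k => hic _) ?_
    have : ∀ k : ℕ, ∫ a in psph p (n - k), ‖Real.log ‖a‖‖ ∂μ =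
        (p : ℝ) ^ n * (1 / p) ^ k * (1 - 1 / p) * (|(n : ℝ) - k| * Real.log p) := by
      intro k
      rw [setIntegral_congr_fun (g := fun _ => |(n : ℝ) - k| * Real.log p) (psph_meas _),
        setIntegral_const, psph_real μ hμ, hz]
      · simp
      · intro x hx
        simp only [log_on_sph hx, norm_mul, Real.norm_eq_abs, abs_of_pos hlog]
        push_cast; rfl
    simp_rw [this]
    have hb : (0 : ℝ) ≤ 1 - 1 / p := by
      rw [Real.norm_of_nonneg (by positivity)] at hr; linarith
    refine Summable.of_nonneg_of_le (fun k => by positivity) (fun k => ?_)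
      (((hs0.summable.mul_left |(n : ℝ)|).add hs1.summable).mul_left
        ((p : ℝ) ^ n * (1 - 1 / p) * Real.log p))
    have h1 : |(n : ℝ) - k| ≤ |(n : ℝ)| + k := by
      have := abs_sub (n : ℝ) k
      rwa [Nat.abs_cast] at this
    calc _ ≤ (p : ℝ) ^ n * (1 / p) ^ k * (1 - 1 / p) * ((|(n : ℝ)| + k) * Real.log p) := by
          gcongr
      _ = _ := by ring
  refine ⟨hI.congr_set_ae hae, ?_⟩
  rw [setIntegral_congr_set hae]
  have hS := hasSum_integral_iUnion (fun k : ℕ => psph_meas (p := p) (n - k)) (by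
    intro a b hab
    rw [Function.onFun, Set.disjoint_left]
    intro x hx hy
    have hx : ‖x‖ = _ := hx
    have hy : ‖x‖ = _ := hy
    rw [hx] at hy
    have := zpow_right_injective₀ (by positivity) hp1.ne' hy
    omega) hI
  refine hS.unique ?_
  have hterm : ∀ k : ℕ, ∫ a in psph p (n - k), Real.log ‖a‖ ∂μ =
      (p : ℝ) ^ n * (1 - 1 / p) * Real.log p * (n * (1 / p) ^ k - k * (1 / p) ^ k) := by
    intro k
    rw [setIntegral_congr_fun (g := fun _ => ((n : ℝ) - k) * Real.log p) (psph_meas _),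
      setIntegral_const, psph_real μ hμ, hz]
    · simp only [smul_eq_mul]; ring
    · intro x hx
      simp only [log_on_sph hx]
      push_cast; rfl
  simp_rw [hterm]
  have := ((hs0.mul_left (n : ℝ)).sub hs1).mul_left ((p : ℝ) ^ n * (1 - 1 / p) * Real.log p)
  refine (congrArg (HasSum _) ?_).mpr this
  have hpm : (p : ℝ) - 1 ≠ 0 := by linarith
  have hpp : (p : ℝ) ≠ 0 := by linarith
  have hq : (1 : ℝ) - 1 / p ≠ 0 := by
    have e1 : (1 : ℝ) - 1 / p = (p - 1) / p := by field_simp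
    rw [e1]; positivity
  have hq' : (1 : ℝ) / (p - 1) = 1 / p / (1 - 1 / p) := by
    rw [div_div, mul_sub, mul_one, mul_one_div_cancel]
    assumption
  rw [hq']
  clear this hterm hS hs0 hs1 hI hq'
  generalize (1 : ℝ) - 1 / p = q at *
  field_simp


/-- The normalizing constant. -/
noncomputable def cc (p : ℕ) (i : ℤ) : ℝ :=
  (1 - 1 / (p : ℝ)) ^ (-(1 / 2 : ℝ)) * (p : ℝ) ^ (-((i : ℝ)) / 2)

/-- The Fourier transform of the indicator function of a sphere. -/
noncomputable def kern (p : ℕ) [Fact p.Prime] (i : ℤ) (ξ : ℚ_[p]) : ℝ :=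
  (pball p (-i)).indicator (fun _ => (p : ℝ) ^ i) ξ -
    (pball p (1 - i)).indicator (fun _ => (p : ℝ) ^ (i - 1)) ξ

lemma eta_eq (i : ℤ) (t : ℚ_[p]) :
    eta i t = (cc p i : ℂ) * (psph p i).indicator (fun _ => (1 : ℂ)) t := by
  classical
  simp [_root_.eta, cc, Set.indicator_apply, psph]

lemma kern_neg (i : ℤ) (ξ : ℚ_[p]) : kern p i (-ξ) = kern p i ξ := by
  classical
  simp [kern, Set.indicator_apply, pball_neg]

lemma eta_fourier (μ : Measure ℚ_[p]) [μ.IsAddHaarMeasure]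
    (hμ : μ {x : ℚ_[p] | ‖x‖ ≤ 1} = 1)
    (e : AddChar ℚ_[p] Circle) (he : Continuous e)
    (he1 : ∀ x : ℤ_[p], e (x : ℚ_[p]) = 1)
    (he2 : ∃ x : ℚ_[p], ‖x‖ ≤ p ∧ e x ≠ 1) (i : ℤ) (ξ : ℚ_[p]) :
    ∫ t, eta i t * (e (t * ξ) : ℂ) ∂μ = (cc p i : ℂ) * (kern p i ξ : ℂ) := by
  have h1 : ∀ t, eta i t * (e (t * ξ) : ℂ) =
      (cc p i : ℂ) * (psph p i).indicator (fun t => (e (t * ξ) : ℂ)) t := by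
    intro t
    rw [eta_eq, mul_assoc]
    by_cases ht : t ∈ psph p i <;> simp [ht]
  simp_rw [h1]
  have hc : Continuous (fun t => (e (t * ξ) : ℂ)) :=
    continuous_subtype_val.comp (he.comp (continuous_id.mul continuous_const))
  have hint : IntegrableOn (fun t => (e (t * ξ) : ℂ)) (pball p i) μ := by
    refine Measure.integrableOn_of_bounded (M := 1) (pball_fin μ i)
      hc.aestronglyMeasurable ?_
    exact Filter.Eventually.of_forall fun t => (Circle.norm_coe _).le
  rw [integral_const_mul, integral_indicator (psph_meas i), psph_eq,
    setIntegral_sdiff (pball_meas _) hint (pball_mono (by omega)),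
    fourier_ball μ hμ e he1 he2, fourier_ball μ hμ e he1 he2]
  classical
  simp only [kern, Set.indicator_apply]
  rw [neg_sub]
  split_ifs <;> push_cast <;> rfl

lemma eta_fourierInv (μ : Measure ℚ_[p]) [μ.IsAddHaarMeasure]
    (hμ : μ {x : ℚ_[p] | ‖x‖ ≤ 1} = 1)
    (e : AddChar ℚ_[p] Circle) (he : Continuous e)
    (he1 : ∀ x : ℤ_[p], e (x : ℚ_[p]) = 1)
    (he2 : ∃ x : ℚ_[p], ‖x‖ ≤ p ∧ e x ≠ 1) (i : ℤ) (ξ : ℚ_[p]) :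
    padicFourierInv μ e (eta i) ξ = (cc p i : ℂ) * (kern p i ξ : ℂ) := by
  rw [← kern_neg, ← eta_fourier μ hμ e he he1 he2]
  simp [padicFourierInv, mul_comm]

lemma kern_meas (i : ℤ) : Measurable (kern p i) :=
  (measurable_const.indicator (pball_meas _)).sub (measurable_const.indicator (pball_meas _))

lemma log_ball_int (μ : Measure ℚ_[p]) [μ.IsAddHaarMeasure]
    (hμ : μ {x : ℚ_[p] | ‖x‖ ≤ 1} = 1) (n : ℤ) (c : ℝ) :
    Integrable (fun x => Real.log ‖x‖ * (pball p n).indicator (fun _ => c) x) μ ∧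
    ∫ x, Real.log ‖x‖ * (pball p n).indicator (fun _ => c) x ∂μ =
      Real.log p * (p : ℝ) ^ n * (n - 1 / (p - 1)) * c := by
  obtain ⟨h1, h2⟩ := log_hasSum μ hμ n
  have : (fun x => Real.log ‖x‖ * (pball p n).indicator (fun _ => c) x) =
      (fun x => (pball p n).indicator (fun x => Real.log ‖x‖) x * c) := by
    funext x
    by_cases hx : x ∈ pball p n <;> simp [hx]
  rw [this, integral_mul_const, integral_indicator (pball_meas n), h2]
  exact ⟨(h1.integrable_indicator (pball_meas n)).mul_const c, rfl⟩

lemma log_kern (μ : Measure ℚ_[p]) [μ.IsAddHaarMeasure]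
    (hμ : μ {x : ℚ_[p] | ‖x‖ ≤ 1} = 1) (j : ℤ) :
    Integrable (fun x => Real.log ‖x‖ * kern p j x) μ ∧
    ∫ x, Real.log ‖x‖ * kern p j x ∂μ = - Real.log p := by
  have hp1 := one_lt_p p
  obtain ⟨h1, h2⟩ := log_ball_int μ hμ (-j) ((p : ℝ) ^ j)
  obtain ⟨h3, h4⟩ := log_ball_int μ hμ (1 - j) ((p : ℝ) ^ (j - 1))
  simp only [kern, mul_sub]
  refine ⟨h1.sub h3, ?_⟩
  rw [integral_sub h1 h3, h2, h4]
  have e1 : (p : ℝ) ^ (-j) * (p : ℝ) ^ j = 1 := by rw [← zpow_add₀ (by positivity)]; simp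
  have e2 : (p : ℝ) ^ (1 - j) * (p : ℝ) ^ (j - 1) = 1 := by
    rw [← zpow_add₀ (by positivity)]; simp
  push_cast
  linear_combination (Real.log p * (-j - 1 / (p - 1))) * e1 -
    (Real.log p * (1 - j - 1 / (p - 1))) * e2

lemma log_kern_lt (μ : Measure ℚ_[p]) [μ.IsAddHaarMeasure]
    (hμ : μ {x : ℚ_[p] | ‖x‖ ≤ 1} = 1) {i j : ℤ} (hij : i < j) :
    ∫ x, Real.log ‖x‖ * kern p i x * kern p j x ∂μ =
      - Real.log p * ((p : ℝ) ^ i * (1 - 1 / p)) := by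
  have hp1 := one_lt_p p
  have : ∀ x : ℚ_[p], Real.log ‖x‖ * kern p i x * kern p j x =
      (Real.log ‖x‖ * kern p j x) * ((p : ℝ) ^ i * (1 - 1 / p)) := by
    intro x
    by_cases hx : x ∈ pball p (1 - j)
    · have h1 : x ∈ pball p (-i) := pball_mono (by omega) hx
      have h2 : x ∈ pball p (1 - i) := pball_mono (by omega) hx
      have : kern p i x = (p : ℝ) ^ i * (1 - 1 / p) := by
        simp only [kern, h1, h2, Set.indicator_of_mem]
        rw [zpow_sub_one₀ (by positivity)]; ring
      rw [this]; ring
    · have h1 : x ∉ pball p (-j) := fun h => hx (pball_mono (by omega) h)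
      have : kern p j x = 0 := by simp [kern, h1, hx]
      rw [this]; ring
  simp_rw [this]
  rw [integral_mul_const, (log_kern μ hμ j).2]

lemma log_kern_diag (μ : Measure ℚ_[p]) [μ.IsAddHaarMeasure]
    (hμ : μ {x : ℚ_[p] | ‖x‖ ≤ 1} = 1) (i : ℤ) :
    ∫ x, Real.log ‖x‖ * kern p i x * kern p i x ∂μ =
      - i * Real.log p * ((p : ℝ) ^ i * (1 - 1 / p)) := by
  have hp1 := one_lt_p p
  obtain ⟨h1, h2⟩ := log_ball_int μ hμ (-i) ((p : ℝ) ^ i * (p : ℝ) ^ i * (1 - 2 / p))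
  obtain ⟨h3, h4⟩ := log_ball_int μ hμ (1 - i) ((p : ℝ) ^ (i - 1) * (p : ℝ) ^ (i - 1))
  have : ∀ x : ℚ_[p], Real.log ‖x‖ * kern p i x * kern p i x =
      Real.log ‖x‖ * (pball p (-i)).indicator
        (fun _ => (p : ℝ) ^ i * (p : ℝ) ^ i * (1 - 2 / p)) x +
      Real.log ‖x‖ * (pball p (1 - i)).indicator
        (fun _ => (p : ℝ) ^ (i - 1) * (p : ℝ) ^ (i - 1)) x := by
    intro x
    by_cases hx : x ∈ pball p (1 - i)
    · by_cases hx' : x ∈ pball p (-i)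
      · simp only [kern, hx, hx', Set.indicator_of_mem]
        rw [zpow_sub_one₀ (by positivity)]; ring
      · simp [kern, hx, hx']; ring
    · have h1 : x ∉ pball p (-i) := fun h => hx (pball_mono (by omega) h)
      simp [kern, h1, hx]
  simp_rw [this]
  rw [integral_add h1 h3, h2, h4]
  have hz : (p : ℝ) ^ i ≠ 0 := by positivity
  have hp0 : (p : ℝ) ≠ 0 := by positivity
  have hp2 : (p : ℝ) - 1 ≠ 0 := by linarith
  rw [zpow_sub_one₀ hp0, zpow_sub₀ hp0, zpow_neg, zpow_one]
  push_cast
  generalize (p : ℝ) ^ i = z at *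
  field_simp
  ring

lemma log_kern_kern_int (μ : Measure ℚ_[p]) [μ.IsAddHaarMeasure]
    (hμ : μ {x : ℚ_[p] | ‖x‖ ≤ 1} = 1) (e : AddChar ℚ_[p] Circle) (he : Continuous e)
    (he1 : ∀ x : ℤ_[p], e (x : ℚ_[p]) = 1)
    (he2 : ∃ x : ℚ_[p], ‖x‖ ≤ p ∧ e x ≠ 1) (i j : ℤ) :
    ∫ t : ℚ_[p], padicCondOp μ e (eta i) t * (starRingEnd ℂ) (eta j t) ∂μ =
      (if i = j then ((i * Real.log p * cc p i ^ 2 * ((p : ℝ) ^ i * (1 - 1 / p)) : ℝ) : ℂ) else 0) +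
      ((cc p i * cc p j * ∫ x, Real.log ‖x‖ * kern p i x * kern p j x ∂μ : ℝ) : ℂ) := by
  have hconj : ∀ t : ℚ_[p], (starRingEnd ℂ) (eta j t) = eta j t := by
    intro t
    rw [eta_eq]
    by_cases ht : t ∈ psph p j <;> simp [ht]
  have hfin : ∀ m, μ (psph p m) ≠ ⊤ := fun m => by
    rw [psph_eq]; exact measure_ne_top_of_subset Set.sdiff_subset (pball_fin μ m)
  have hetai : Integrable (eta (p := p) j) μ := by
    have : eta (p := p) j = fun t => (cc p j : ℂ) * (psph p j).indicator (fun _ => (1 : ℂ)) t :=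
      funext fun t => eta_eq j t
    rw [this]
    exact ((integrable_indicator_iff (psph_meas j)).2 (integrableOn_const (hfin j))).const_mul _
  -- the multiplication part
  have hA : ∀ t : ℚ_[p], (Real.log ‖t‖ : ℂ) * eta i t * eta j t =
      (psph p i).indicator (fun _ => if i = j then
        ((i * Real.log p * cc p i ^ 2 : ℝ) : ℂ) else 0) t := by
    intro t
    rw [eta_eq, eta_eq]
    by_cases ht : t ∈ psph p i
    · by_cases hij : i = j
      · subst hij
        simp [ht, log_on_sph ht]; ring
      · have : t ∉ psph p j := by
          intro h
          have h1 : ‖t‖ = _ := ht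
          have h2 : ‖t‖ = _ := h
          rw [h1] at h2
          have hp1 := one_lt_p p
          exact hij (zpow_right_injective₀ (by positivity) hp1.ne' h2)
        simp [this, hij]
    · simp [ht]
  have hAint : Integrable (fun t : ℚ_[p] => (Real.log ‖t‖ : ℂ) * eta i t * eta j t) μ := by
    simp_rw [hA]
    exact (integrable_indicator_iff (psph_meas i)).2 (integrableOn_const (hfin i))
  -- the convolution part
  let G : ℚ_[p] → ℚ_[p] → ℂ := fun t ξ =>
    (((Real.log ‖ξ‖ * kern p i ξ : ℝ) : ℂ) * cc p i) * (e (t * ξ) : ℂ) * eta j t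
  have hG : Integrable (Function.uncurry G) (μ.prod μ) := by
    have h1 : Integrable (fun z : ℚ_[p] × ℚ_[p] => eta j z.1 *
        (((Real.log ‖z.2‖ * kern p i z.2 : ℝ) : ℂ) * cc p i)) (μ.prod μ) :=
      hetai.mul_prod ((log_kern μ hμ i).1.ofReal.mul_const (cc p i : ℂ))
    have hc : Continuous (fun z : ℚ_[p] × ℚ_[p] => (e (z.1 * z.2) : ℂ)) :=
      continuous_subtype_val.comp (he.comp (continuous_fst.mul continuous_snd))
    have h2 := h1.bdd_mul (c := 1) hc.aestronglyMeasurable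
      (Filter.Eventually.of_forall fun z => (Circle.norm_coe _).le)
    refine h2.congr (Filter.Eventually.of_forall fun z => ?_)
    simp only [Function.uncurry, G]
    ring
  have hB : ∀ t : ℚ_[p], padicCondOp μ e (eta i) t * (starRingEnd ℂ) (eta j t) =
      (Real.log ‖t‖ : ℂ) * eta i t * eta j t + ∫ ξ, G t ξ ∂μ := by
    intro t
    simp only [hconj, padicCondOp, add_mul, G]
    rw [← integral_mul_const]
    congr 2
    funext ξ
    rw [eta_fourierInv μ hμ e he he1 he2]
    push_cast
    ring
  simp_rw [hB]
  have hG2 : Integrable (fun t => ∫ ξ, G t ξ ∂μ) μ := hG.integral_prod_left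
  rw [integral_add hAint hG2, integral_integral_swap hG]
  congr 1
  · simp_rw [hA]
    rw [integral_indicator (psph_meas i), setIntegral_const, psph_real μ hμ]
    split_ifs
    · rw [Complex.real_smul]; push_cast; ring
    · simp
  · have : ∀ ξ, ∫ t, G t ξ ∂μ =
        ((cc p i * cc p j * (Real.log ‖ξ‖ * kern p i ξ * kern p j ξ) : ℝ) : ℂ) := by
      intro ξ
      have h1 : ∀ t, G t ξ = (((Real.log ‖ξ‖ * kern p i ξ : ℝ) : ℂ) * cc p i) *
          (eta j t * (e (t * ξ) : ℂ)) := by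
        intro t; simp only [G]; ring
      simp_rw [h1]
      rw [integral_const_mul, eta_fourier μ hμ e he he1 he2]
      push_cast; ring
    simp_rw [this]
    rw [← integral_const_mul]
    exact integral_ofReal

lemma cc_mul (p : ℕ) [Fact p.Prime] (i j : ℤ) :
    cc p i * cc p j * ((p : ℝ) ^ i * (1 - 1 / p)) = (p : ℝ) ^ (((i - j : ℤ) : ℝ) / 2) := by
  have hp1 := one_lt_p p
  have hp0 : (0 : ℝ) < p := by positivity
  have hq : (0 : ℝ) < 1 - 1 / p := by
    rw [sub_pos, div_lt_one hp0]; exact hp1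
  have e1 : (1 - 1 / (p : ℝ)) ^ (-(1 / 2 : ℝ)) * (1 - 1 / (p : ℝ)) ^ (-(1 / 2 : ℝ)) *
      (1 - 1 / (p : ℝ)) = 1 := by
    rw [← Real.rpow_add hq]
    norm_num
    rw [Real.rpow_neg_one]
    apply inv_mul_cancel₀
    simpa using hq.ne'
  have e2 : (p : ℝ) ^ (-((i : ℝ)) / 2) * (p : ℝ) ^ (-((j : ℝ)) / 2) * (p : ℝ) ^ i =
      (p : ℝ) ^ (((i - j : ℤ) : ℝ) / 2) := by
    rw [← Real.rpow_intCast, ← Real.rpow_add hp0, ← Real.rpow_add hp0]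
    congr 1
    push_cast; ring
  rw [← e2, cc, cc]
  linear_combination ((p : ℝ) ^ (-((i : ℝ)) / 2) * (p : ℝ) ^ (-((j : ℝ)) / 2) * (p : ℝ) ^ i) * e1

end

/-- Matrix elements of the conductor operator in the orthonormal family `η_i`:
`⟨H(η_i), η_j⟩ = −log(p)·p^{−|i−j|/2}` for `i ≠ j`, and `⟨H(η_i), η_i⟩ = 0`. -/
theorem conductor_matrix_elements [MeasurableSpace ℚ_[p]] [BorelSpace ℚ_[p]]
    (μ : Measure ℚ_[p]) [μ.IsAddHaarMeasure] (hμ : μ {x : ℚ_[p] | ‖x‖ ≤ 1} = 1)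
    (e : AddChar ℚ_[p] Circle) (he : Continuous e)
    (he1 : ∀ x : ℤ_[p], e (x : ℚ_[p]) = 1)
    (he2 : ∃ x : ℚ_[p], ‖x‖ ≤ p ∧ e x ≠ 1) :
    (∀ i j : ℤ, i ≠ j →
      (∫ t : ℚ_[p], padicCondOp μ e (eta i) t * (starRingEnd ℂ) (eta j t) ∂μ) =
        ((-Real.log p * (p : ℝ) ^ (-((|i - j| : ℤ) : ℝ) / 2) : ℝ) : ℂ)) ∧
    (∀ i : ℤ,
      (∫ t : ℚ_[p], padicCondOp μ e (eta i) t * (starRingEnd ℂ) (eta i t) ∂μ) = 0) := by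
  refine ⟨fun i j hij => ?_, fun i => ?_⟩
  · rw [log_kern_kern_int μ hμ e he he1 he2, if_neg hij, zero_add]
    congr 1
    rcases lt_or_gt_of_ne hij with h | h
    · have h1 := cc_mul p i j
      have h2 : -((|i - j| : ℤ) : ℝ) = ((i - j : ℤ) : ℝ) := by
        rw [abs_of_neg (by omega)]; push_cast; ring
      rw [log_kern_lt μ hμ h, h2, ← h1]
      ring
    · have h1 := cc_mul p j i
      have h2 : -((|i - j| : ℤ) : ℝ) = ((j - i : ℤ) : ℝ) := by
        rw [abs_of_pos (by omega)]; push_cast; ring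
      have h3 : ∫ x, Real.log ‖x‖ * kern p i x * kern p j x ∂μ =
          ∫ x, Real.log ‖x‖ * kern p j x * kern p i x ∂μ := by
        congr 1; funext x; ring
      rw [h3, log_kern_lt μ hμ h, h2, ← h1]
      ring
  · rw [log_kern_kern_int μ hμ e he he1 he2, if_pos rfl, log_kern_diag μ hμ, ← Complex.ofReal_add]
    rw [Complex.ofReal_eq_zero]
    ring
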